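/- Let A be a separable C*-algebra, Q = B(ℓ²)/𝒦(ℓ²) the Calkin algebra with quotient map q, and V₁, V₂ ∈ B(ℓ²) isometries with V₁V₁* + V₂V₂* = 1. Then every *-homomorphism φ : SA → Q is strongly homotopic to φ ⊕ 0 = q(V₁)φ(·)q(V₁)*, i.e. there is a path Φ_s : SA → Q, s ∈ [0,1], of *-homomorphisms with Φ₀ = φ, Φ₁ = q(V₁)φ(·)q(V₁)* and s ↦ Φ_s(x) norm-continuous for every x ∈ SA. -/

import Mathlib

open Filter Topology Set
open scoped MultiplierAlgebra ZeroAtInfty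

noncomputable section

/-- The open unit interval; `C₀(I01, A)` is the suspension `SA`. -/
abbrev I01 : Set ℝ := Set.Ioo 0 1
/-- The half-open unit interval; `C₀(cI01, A)` is the cone of `A`. -/
abbrev cI01 : Set ℝ := Set.Ioc 0 1
/-- The closed unit interval. -/
abbrev uI : Set ℝ := Set.Icc 0 1

/-- An action of a group `G` on a complex star algebra `A` by `*`-automorphisms
(no continuity requirements; surjectivity follows from the group laws). -/
structure StarAct (G A : Type) [Monoid G] [Add A] [Mul A] [SMul ℂ A] [Star A] where
  ρ : G → A → A
  map_add : ∀ g a b, ρ g (a + b) = ρ g a + ρ g b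
  map_smul : ∀ g (c : ℂ) a, ρ g (c • a) = c • ρ g a
  map_mul : ∀ g a b, ρ g (a * b) = ρ g a * ρ g b
  map_star : ∀ g a, ρ g (star a) = star (ρ g a)
  act_one : ∀ a, ρ 1 a = a
  act_mul : ∀ g h a, ρ (g * h) a = ρ g (ρ h a)

/-- The action is pointwise (norm) continuous, i.e. `g ↦ g • a` is continuous.  Together
with `StarAct` this is the structure of a `G`-algebra. -/
def StarAct.PtwiseCont {G A : Type} [Monoid G] [TopologicalSpace G] [Add A] [Mul A]
    [SMul ℂ A] [Star A] [TopologicalSpace A] (α : StarAct G A) : Prop :=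
  ∀ a, Continuous fun g => α.ρ g a

/-- Each automorphism of the action is continuous (this is automatic for `*`-automorphisms
of C*-algebras). -/
def StarAct.ContAuto {G A : Type} [Monoid G] [Add A] [Mul A]
    [SMul ℂ A] [Star A] [TopologicalSpace A] (α : StarAct G A) : Prop :=
  ∀ g, Continuous (α.ρ g)

/-- Equivariance of a map with respect to two actions. -/
def Equivariant {G A B : Type} [Monoid G] [Add A] [Mul A] [SMul ℂ A] [Star A]
    [Add B] [Mul B] [SMul ℂ B] [Star B]
    (α : StarAct G A) (β : StarAct G B) (φ : A → B) : Prop :=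
  ∀ g a, φ (α.ρ g a) = β.ρ g (φ a)

/-- `φ` is a (not necessarily unital) `*`-homomorphism. -/
def IsStarHom {A B : Type} [Add A] [Mul A] [SMul ℂ A] [Star A]
    [Add B] [Mul B] [SMul ℂ B] [Star B] (φ : A → B) : Prop :=
  (∀ a b, φ (a + b) = φ a + φ b) ∧ (∀ (c : ℂ) a, φ (c • a) = c • φ a) ∧
    (∀ a b, φ (a * b) = φ a * φ b) ∧ (∀ a, φ (star a) = star (φ a))

/-- An (equivariant) asymptotic homomorphism `π = (π_t)_{t ∈ [1,∞)} : A → B`. -/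
def IsAsymHom {G A B : Type} [Monoid G] [Add A] [Mul A] [SMul ℂ A] [Star A]
    [AddCommGroup B] [Mul B] [SMul ℂ B] [Star B] [TopologicalSpace B]
    (α : StarAct G A) (β : StarAct G B) (π : ℝ → A → B) : Prop :=
  (∀ a, ContinuousOn (fun t => π t a) (Set.Ici (1:ℝ))) ∧
  (∀ a b, Tendsto (fun t => π t (a + b) - π t a - π t b) atTop (𝓝 0)) ∧
  (∀ (c : ℂ) (a : A), Tendsto (fun t => π t (c • a) - c • π t a) atTop (𝓝 0)) ∧
  (∀ a b, Tendsto (fun t => π t (a * b) - π t a * π t b) atTop (𝓝 0)) ∧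
  (∀ a, Tendsto (fun t => π t (star a) - star (π t a)) atTop (𝓝 0)) ∧
  (∀ g a, Tendsto (fun t => β.ρ g (π t a) - π t (α.ρ g a)) atTop (𝓝 0))

/-- Homotopy of asymptotic homomorphisms, via an asymptotic homomorphism into
`C([0,1], B)`; `βI` is the pointwise action of `G` on `C([0,1], B)`. -/
def AsymHomotopic {G A B : Type} [Monoid G] [Add A] [Mul A] [SMul ℂ A] [Star A]
    [NonUnitalCStarAlgebra B]
    (α : StarAct G A) (βI : StarAct G C(uI, B)) (φ ψ : ℝ → A → B) : Prop :=
  ∃ Φ : ℝ → A → C(uI, B), IsAsymHom α βI Φ ∧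
    ∀ t, 1 ≤ t → ∀ a, Φ t a ⟨0, by norm_num⟩ = φ t a ∧ Φ t a ⟨1, by norm_num⟩ = ψ t a

/-- A `G`-extension of `A` by `B`, presented by its Busby invariant, i.e. an equivariant
`*`-homomorphism into the corona algebra. -/
def IsGExt {G A Q : Type} [Monoid G] [Add A] [Mul A] [SMul ℂ A] [Star A]
    [Add Q] [Mul Q] [SMul ℂ Q] [Star Q]
    (α : StarAct G A) (κ : StarAct G Q) (φ : A → Q) : Prop :=
  IsStarHom φ ∧ Equivariant α κ φ

/-- The extension `φ` is asymptotically split: it lifts to an asymptotic homomorphism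
into the multiplier algebra. -/
def AsymSplit {G A B QB : Type} [Monoid G] [Add A] [Mul A] [SMul ℂ A] [Star A]
    [NonUnitalCStarAlgebra B] [CStarAlgebra QB]
    (α : StarAct G A) (actM : StarAct G 𝓜(ℂ, B)) (qB : 𝓜(ℂ, B) → QB) (φ : A → QB) : Prop :=
  ∃ π : ℝ → A → 𝓜(ℂ, B), IsAsymHom α actM π ∧ ∀ t, 1 ≤ t → ∀ a, qB (π t a) = φ a

/-- `V₁, V₂` are `G`-invariant isometries with `V₁V₁* + V₂V₂* = 1`, used to define the sum
of extensions. -/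
def SumIsometries {G B : Type} [Monoid G] [NonUnitalCStarAlgebra B]
    (actM : StarAct G 𝓜(ℂ, B)) (V₁ V₂ : 𝓜(ℂ, B)) : Prop :=
  (∀ g, actM.ρ g V₁ = V₁) ∧ (∀ g, actM.ρ g V₂ = V₂) ∧
    star V₁ * V₁ = 1 ∧ star V₂ * V₂ = 1 ∧ V₁ * star V₁ + V₂ * star V₂ = 1

/-- The sum `φ ⊕ ψ` of two extensions, relative to the isometries `V₁, V₂`. -/
def ExtSum {B A QB : Type} [NonUnitalCStarAlgebra B] [CStarAlgebra QB]
    (qB : 𝓜(ℂ, B) → QB) (V₁ V₂ : 𝓜(ℂ, B)) (φ ψ : A → QB) : A → QB :=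
  fun a => qB V₁ * φ a * star (qB V₁) + qB V₂ * ψ a * star (qB V₂)

/-- Unitary equivalence of extensions: conjugacy by `q_B(w)` for a unitary `w ∈ M(B)` with
`q_B(w)` `G`-invariant. -/
def UnitEquiv {G A B QB : Type} [Monoid G] [NonUnitalCStarAlgebra B] [CStarAlgebra QB]
    (actQ : StarAct G QB) (qB : 𝓜(ℂ, B) → QB) (φ ψ : A → QB) : Prop :=
  ∃ w : 𝓜(ℂ, B), star w * w = 1 ∧ w * star w = 1 ∧ (∀ g, actQ.ρ g (qB w) = qB w) ∧
    ∀ a, qB w * φ a * star (qB w) = ψ a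

/-- Stable unitary equivalence: unitary equivalence after adding a common asymptotically
split extension. -/
def StablyUEq {G A B QB : Type} [Monoid G] [Add A] [Mul A] [SMul ℂ A] [Star A]
    [NonUnitalCStarAlgebra B] [CStarAlgebra QB]
    (α : StarAct G A) (actM : StarAct G 𝓜(ℂ, B)) (actQ : StarAct G QB)
    (qB : 𝓜(ℂ, B) → QB) (V₁ V₂ : 𝓜(ℂ, B)) (φ ψ : A → QB) : Prop :=
  ∃ lam : A → QB, IsGExt α actQ lam ∧ AsymSplit α actM qB lam ∧
    UnitEquiv actQ qB (ExtSum qB V₁ V₂ φ lam) (ExtSum qB V₁ V₂ ψ lam)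

/-- Semi-invertibility of an extension. -/
def SemiInvertible {G A B QB : Type} [Monoid G] [Add A] [Mul A] [SMul ℂ A] [Star A]
    [NonUnitalCStarAlgebra B] [CStarAlgebra QB]
    (α : StarAct G A) (actM : StarAct G 𝓜(ℂ, B)) (actQ : StarAct G QB)
    (qB : 𝓜(ℂ, B) → QB) (V₁ V₂ : 𝓜(ℂ, B)) (φ : A → QB) : Prop :=
  ∃ ψ : A → QB, IsGExt α actQ ψ ∧ AsymSplit α actM qB (ExtSum qB V₁ V₂ φ ψ)

/-- Strong homotopy of extensions: a pointwise norm-continuous path of extensions. -/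
def StrHomotopicExt {G A QB : Type} [Monoid G] [Add A] [Mul A] [SMul ℂ A] [Star A]
    [Add QB] [Mul QB] [SMul ℂ QB] [Star QB] [TopologicalSpace QB]
    (α : StarAct G A) (actQ : StarAct G QB) (φ ψ : A → QB) : Prop :=
  ∃ Φ : ℝ → A → QB, (∀ s ∈ Set.Icc (0:ℝ) 1, IsGExt α actQ (Φ s)) ∧ Φ 0 = φ ∧ Φ 1 = ψ ∧
    ∀ a, ContinuousOn (fun s => Φ s a) (Set.Icc (0:ℝ) 1)

/-- Weak stability of `B` (i.e. `B ≅ B ⊗ 𝒦` equivariantly, with the trivial action on `𝒦`),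
expressed through the standard characterization: a sequence of `G`-invariant isometries
in `M(B)` with orthogonal ranges whose range projections sum strictly to `1`. -/
def WeaklyStableWrt {G B : Type} [Monoid G] [NonUnitalCStarAlgebra B]
    (actM : StarAct G 𝓜(ℂ, B)) : Prop :=
  ∃ V : ℕ → 𝓜(ℂ, B),
    (∀ n g, actM.ρ g (V n) = V n) ∧
    (∀ n, star (V n) * V n = 1) ∧
    (∀ m n, m ≠ n → star (V m) * V n = 0) ∧
    (∀ b : B, Tendsto (fun N => (∑ n ∈ Finset.range N, V n * star (V n)) * (b : 𝓜(ℂ, B)))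
      atTop (𝓝 (b : 𝓜(ℂ, B)))) ∧
    (∀ b : B, Tendsto (fun N => (b : 𝓜(ℂ, B)) * ∑ n ∈ Finset.range N, V n * star (V n))
      atTop (𝓝 (b : 𝓜(ℂ, B))))


/-- In a separable Hilbert space, an operator which is not bounded below on any subspace of finite
codimension is compact on the range of some isometry. -/
theorem exists_isometry_isCompactOperator_mul
    {H : Type} [NormedAddCommGroup H] [InnerProductSpace ℂ H] [CompleteSpace H]
    [TopologicalSpace.SeparableSpace H] (T : H →L[ℂ] H)
    (hT : ∀ (s : Finset H) (ε : ℝ), 0 < ε →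
      ∃ e : H, ‖e‖ = 1 ∧ (∀ x ∈ s, inner ℂ x e = 0) ∧ ‖T e‖ < ε) :
    ∃ W : H →L[ℂ] H, star W * W = 1 ∧ IsCompactOperator (T * W) := by
  classical
  obtain ⟨f, hf, hfr⟩ := exists_seq_of_forall_finset_exists
    (fun p : H × ℕ => ‖p.1‖ = 1 ∧ ‖T p.1‖ < (1 / 2) ^ p.2)
    (fun p p' => inner ℂ p.1 p'.1 = 0 ∧ p.2 < p'.2) (fun s _ => by
      obtain ⟨e, he, hes, heT⟩ := hT (s.image Prod.fst) ((1 / 2) ^ (s.sup Prod.snd + 1))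
        (by positivity)
      exact ⟨(e, s.sup Prod.snd + 1), ⟨he, heT⟩, fun x hx =>
        ⟨hes _ (Finset.mem_image_of_mem _ hx), Nat.lt_succ_of_le (Finset.le_sup hx)⟩⟩)
  have hmono : StrictMono fun n => (f n).2 := fun m n h => (hfr m n h).2
  have horth : Orthonormal ℂ fun n => (f n).1 := by
    refine ⟨fun n => (hf n).1, fun m n hmn => ?_⟩
    rcases lt_or_gt_of_ne hmn with h | h
    · exact (hfr m n h).1
    · exact inner_eq_zero_symm.1 (hfr n m h).1
  have hsmall (n : ℕ) : ‖T (f n).1‖ ≤ (1 / 2) ^ n :=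
    (hf n).2.le.trans (pow_le_pow_of_le_one (by norm_num) (by norm_num) (hmono.id_le n))
  obtain ⟨w, b, hb⟩ := exists_hilbertBasis ℂ H
  have hcount : w.Countable := by
    refine Set.PairwiseDisjoint.countable_of_isOpen (s := fun x : H => Metric.ball x (1 / 2))
      (fun x hx y hy hxy => ?_) (fun _ _ => Metric.isOpen_ball)
      (fun x _ => Metric.nonempty_ball.2 (by norm_num))
    refine Metric.ball_disjoint_ball ?_
    have ho := b.orthonormal
    rw [hb] at ho
    have h0 : inner ℂ x y = 0 := ho.2 (i := ⟨x, hx⟩) (j := ⟨y, hy⟩) (by simpa using hxy)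
    have h1 : ‖x‖ = 1 := ho.1 ⟨x, hx⟩
    have h2 : ‖y‖ = 1 := ho.1 ⟨y, hy⟩
    have h3 := norm_sub_sq (𝕜 := ℂ) x y
    rw [h0, h1, h2] at h3
    simp only [map_zero] at h3
    rw [dist_eq_norm]
    nlinarith [norm_nonneg (x - y)]
  have := hcount.to_subtype
  obtain ⟨j, hj⟩ := exists_injective_nat w
  have horth' : Orthonormal ℂ fun i => (f (j i)).1 := horth.comp j hj
  set U : H →ₗᵢ[ℂ] H := horth'.orthogonalFamily.linearIsometry.comp b.repr.toLinearIsometry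
  have hU (x : H) : HasSum (fun i => b.repr x i • (f (j i)).1) (U x) := by
    simpa using! horth'.orthogonalFamily.hasSum_linearIsometry (b.repr x)
  let K : w → H →L[ℂ] H := fun i => (innerSL ℂ (b i)).smulRight (T (f (j i)).1)
  have hKs : Summable K := by
    refine Summable.of_norm_bounded (g := fun i => (1 / 2 : ℝ) ^ j i)
      ((summable_geometric_of_lt_one (by norm_num) (by norm_num)).comp_injective hj) fun i => ?_
    rw [ContinuousLinearMap.norm_smulRight_apply, innerSL_apply_norm, b.orthonormal.1 i, one_mul]
    exact hsmall _
  have hK : ∑' i, K i = T * U.toContinuousLinearMap := by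
    ext x
    have h1 := (hKs.hasSum.mapL (ContinuousLinearMap.apply ℂ H x))
    have h2 := (hU x).mapL T
    refine h1.unique ?_
    simpa [K, b.repr_apply_apply] using! h2
  refine ⟨U.toContinuousLinearMap, ?_, ?_⟩
  · exact ContinuousLinearMap.norm_map_iff_adjoint_comp_self _ |>.1 U.norm_map
  · rw [← hK]
    refine isCompactOperator_of_tendsto (F := fun s : Finset w => ∑ i ∈ s, K i) hKs.hasSum
      (Eventually.of_forall fun s => ?_)
    have hmem := (compactOperator (RingHom.id ℂ) H H).sum_mem (t := s)
      (f := K) fun i _ =>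
        (isCompactOperator_of_locallyCompactSpace_dom (innerSL ℂ (b i))).clm_comp
          (ContinuousLinearMap.toSpanSingleton ℂ (T (f (j i)).1))
    exact hmem

/-- An element of the Calkin algebra which is not left invertible annihilates an isometry. -/
theorem exists_isometry_mul_eq_zero
    {H : Type} [NormedAddCommGroup H] [InnerProductSpace ℂ H] [CompleteSpace H]
    [TopologicalSpace.SeparableSpace H]
    {Q : Type} [CStarAlgebra Q] (q : (H →L[ℂ] H) →⋆ₐ[ℂ] Q) (hqsurj : Function.Surjective q)
    (hqker : ∀ T : H →L[ℂ] H, q T = 0 ↔ IsCompactOperator T)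
    (y : Q) (hy : ¬ IsUnit (star y * y)) : ∃ w : Q, star w * w = 1 ∧ y * w = 0 := by
  obtain ⟨T, rfl⟩ := hqsurj y
  suffices hT : ∀ (s : Finset H) (ε : ℝ), 0 < ε →
      ∃ e : H, ‖e‖ = 1 ∧ (∀ x ∈ s, inner ℂ x e = 0) ∧ ‖T e‖ < ε by
    obtain ⟨W, hW, hTW⟩ := exists_isometry_isCompactOperator_mul T hT
    exact ⟨q W, by rw [← map_star, ← map_mul, hW, map_one], by rw [← map_mul, hqker]; exact hTW⟩
  by_contra! hcon
  obtain ⟨s, ε, hε, hs⟩ := hcon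
  refine hy ?_
  let F : Submodule ℂ H := Submodule.span ℂ (s : Set H)
  let P : H →L[ℂ] H := F.starProjection
  have hP : q P = 0 := by
    rw [hqker]
    exact (isCompactOperator_of_locallyCompactSpace_dom F.orthogonalProjectionOnto).clm_comp
      F.subtypeL
  have hR : IsUnit (star (T * (1 - P)) * (T * (1 - P)) + P) := by
    have hc : 0 < min (ε ^ 2) 1 := by positivity
    refine ContinuousLinearMap.isUnit_of_forall_le_norm_inner_map _ (c := ⟨_, hc.le⟩) hc fun x => ?_
    have h0 : inner ℂ (P x) (x - P x) = 0 :=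
      inner_eq_zero_symm.1 (F.starProjection_inner_eq_zero x _ (F.starProjection_apply_mem x))
    have hPx : inner ℂ (P x) x = ((‖P x‖ ^ 2 : ℝ) : ℂ) := by
      rw [← sub_add_cancel x (P x), inner_add_right, sub_add_cancel, h0, zero_add,
        inner_self_eq_norm_sq_to_K]
      simp
    have hTx : inner ℂ ((star (T * (1 - P)) * (T * (1 - P))) x) x
        = ((‖T (x - P x)‖ ^ 2 : ℝ) : ℂ) := by
      rw [mul_apply_eq_comp, ContinuousLinearMap.star_eq_adjoint,
        ContinuousLinearMap.adjoint_inner_left, inner_self_eq_norm_sq_to_K]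
      simp
    have hx : ‖x‖ ^ 2 = ‖x - P x‖ ^ 2 + ‖P x‖ ^ 2 := by
      have := norm_add_sq_eq_norm_sq_add_norm_sq_of_inner_eq_zero _ _ h0
      rw [add_sub_cancel] at this
      linarith
    have hb : ε * ‖x - P x‖ ≤ ‖T (x - P x)‖ := by
      rcases eq_or_ne (x - P x) 0 with h0 | h0
      · simp [h0]
      have hn : 0 < ‖x - P x‖ := norm_pos_iff.2 h0
      have := hs ((‖x - P x‖⁻¹ : ℂ) • (x - P x)) (by
        rw [norm_smul]; simp [hn.ne']) (fun z hz => by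
        rw [inner_smul_right, inner_eq_zero_symm.1
          (F.starProjection_inner_eq_zero x z (Submodule.subset_span hz)), mul_zero])
      rw [map_smul, norm_smul, norm_inv, Complex.norm_real, norm_norm, ← div_eq_inv_mul,
        le_div_iff₀ hn] at this
      exact this
    rw [add_apply, inner_add_left, hPx, hTx, ← Complex.ofReal_add,
      Complex.norm_real, Real.norm_of_nonneg (by positivity)]
    change ‖x‖ ^ 2 * min (ε ^ 2) 1 ≤ _
    have h1 : (ε * ‖x - P x‖) ^ 2 ≤ ‖T (x - P x)‖ ^ 2 := by gcongr
    nlinarith [mul_le_mul_of_nonneg_left (min_le_left (ε ^ 2) 1) (sq_nonneg ‖x - P x‖),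
      mul_le_mul_of_nonneg_left (min_le_right (ε ^ 2) 1) (sq_nonneg ‖P x‖)]
  simpa [map_star, hP] using hR.map q

open Classical in
/-- The extension by zero of an element of the suspension to the real line. -/
def extendZero {A : Type} [NonUnitalCStarAlgebra A] (f : C₀(I01, A)) (t : ℝ) : A :=
  if h : t ∈ I01 then f ⟨t, h⟩ else 0

theorem extendZero_of_mem {A : Type} [NonUnitalCStarAlgebra A] (f : C₀(I01, A)) {t : ℝ}
    (h : t ∈ I01) : extendZero f t = f ⟨t, h⟩ := dif_pos h

theorem extendZero_of_notMem {A : Type} [NonUnitalCStarAlgebra A] (f : C₀(I01, A)) {t : ℝ}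
    (h : t ∉ I01) : extendZero f t = 0 := dif_neg h

theorem continuous_extendZero {A : Type} [NonUnitalCStarAlgebra A] (f : C₀(I01, A)) :
    Continuous (extendZero f) := by
  refine continuous_iff_continuousAt.2 fun t => ?_
  by_cases ht : t ∈ I01
  · have hopen : IsOpen I01 := isOpen_Ioo
    refine (hopen.isOpenEmbedding_subtypeVal.continuousAt_iff (x := ⟨t, ht⟩)).1 ?_
    convert! f.continuous.continuousAt (x := ⟨t, ht⟩) using 1
    ext x
    exact extendZero_of_mem f x.2
  · rw [ContinuousAt, extendZero_of_notMem f ht, Metric.tendsto_nhds]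
    intro ε hε
    obtain ⟨K, hK, hKs⟩ := Filter.mem_cocompact.1 (f.zero_at_infty' (Metric.ball_mem_nhds 0 hε))
    have hmem : (Subtype.val '' K)ᶜ ∈ 𝓝 t :=
      (hK.image continuous_subtype_val).isClosed.isOpen_compl.mem_nhds (by
        rintro ⟨x, -, rfl⟩
        exact ht x.2)
    filter_upwards [hmem] with x hx
    by_cases hxI : x ∈ I01
    · rw [extendZero_of_mem f hxI]
      exact hKs fun h => hx ⟨_, h, rfl⟩
    · simpa [extendZero_of_notMem f hxI] using hε

theorem uniformContinuous_extendZero {A : Type} [NonUnitalCStarAlgebra A] (f : C₀(I01, A)) :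
    UniformContinuous (extendZero f) := by
  refine (continuous_extendZero f).uniformContinuous_of_tendsto_cocompact (x := 0) ?_
  refine tendsto_const_nhds.congr' ?_
  filter_upwards [(isCompact_Icc (a := (0 : ℝ)) (b := 1)).compl_mem_cocompact] with t ht
  exact (extendZero_of_notMem f fun h => ht (Ioo_subset_Icc_self h)).symm

/-- A continuous function vanishing at the endpoints of the unit interval, as an element of the
suspension. -/
def restrictSuspension {A : Type} [NonUnitalCStarAlgebra A] (h : ℝ → A) (hc : Continuous h)
    (h0 : h 0 = 0) (h1 : h 1 = 0) : C₀(I01, A) where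
  toFun t := h t
  continuous_toFun := hc.comp continuous_subtype_val
  zero_at_infty' := by
    refine Metric.tendsto_nhds.2 fun ε hε => Filter.mem_cocompact.2
      ⟨Subtype.val ⁻¹' {t | t ∈ uI ∧ ε ≤ ‖h t‖}, ?_, fun t ht => ?_⟩
    · rw [Subtype.isCompact_iff, Subtype.image_preimage_coe, inter_eq_self_of_subset_right]
      · exact isCompact_Icc.inter_right (isClosed_le continuous_const hc.norm)
      · rintro t ⟨ht, hε'⟩
        refine ⟨lt_of_le_of_ne ht.1 ?_, lt_of_le_of_ne ht.2 ?_⟩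
        · rintro rfl
          simp [h0] at hε'
          linarith
        · rintro rfl
          simp [h1] at hε'
          linarith
    · by_contra hcon
      exact ht ⟨Ioo_subset_Icc_self t.2, by simpa using hcon⟩

/-- The endomorphism of the suspension stretching the unit interval by the factor `1 + |s|`
around the point `c` and discarding what leaves the interval. -/
def stretch {A : Type} [NonUnitalCStarAlgebra A] (c : uI) (s : ℝ) (f : C₀(I01, A)) :
    C₀(I01, A) :=
  restrictSuspension (fun t => extendZero f ((1 + |s|) * t - c * |s|))
    ((continuous_extendZero f).comp (by fun_prop))
    (extendZero_of_notMem f fun h => by nlinarith [h.1, c.2.1, abs_nonneg s])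
    (extendZero_of_notMem f fun h => by nlinarith [h.2, c.2.2, abs_nonneg s])

theorem stretch_apply {A : Type} [NonUnitalCStarAlgebra A] (c : uI) (s : ℝ) (f : C₀(I01, A))
    (t : I01) : stretch c s f t = extendZero f ((1 + |s|) * t - c * |s|) := rfl

theorem stretch_zero {A : Type} [NonUnitalCStarAlgebra A] (c : uI) (f : C₀(I01, A)) :
    stretch c 0 f = f := by
  ext t
  simp [stretch_apply, extendZero_of_mem f t.2]

theorem isStarHom_stretch {A : Type} [NonUnitalCStarAlgebra A] (c : uI) (s : ℝ) :
    IsStarHom (stretch c s : C₀(I01, A) → C₀(I01, A)) := by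
  refine ⟨fun f g => ?_, fun z f => ?_, fun f g => ?_, fun f => ?_⟩ <;> ext t <;>
    by_cases h : (1 + |s|) * (t : ℝ) - c * |s| ∈ I01 <;>
    simp [stretch_apply, extendZero_of_mem, extendZero_of_notMem, h]

theorem stretch_zero_mul_stretch_one {A : Type} [NonUnitalCStarAlgebra A] (f g : C₀(I01, A)) :
    stretch 0 1 f * stretch 1 1 g = 0 := by
  ext t
  by_cases h : (1 + |1|) * (t : ℝ) - (0 : uI) * |1| ∈ I01
  · have h' : (1 + |1|) * (t : ℝ) - (1 : uI) * |1| ∉ I01 := fun h' => by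
      have h1 := h.2
      have h2 := h'.1
      norm_num at h1 h2
      linarith
    simp only [ZeroAtInftyContinuousMap.coe_mul, Pi.mul_apply, stretch_apply,
      extendZero_of_notMem _ h', mul_zero, ZeroAtInftyContinuousMap.coe_zero, Pi.zero_apply]
  · simp only [ZeroAtInftyContinuousMap.coe_mul, Pi.mul_apply, stretch_apply,
      extendZero_of_notMem _ h, zero_mul, ZeroAtInftyContinuousMap.coe_zero, Pi.zero_apply]

theorem dist_suspension_le {A : Type} [NonUnitalCStarAlgebra A] {f g : C₀(I01, A)} {C : ℝ}
    (hC : 0 ≤ C) : dist f g ≤ C ↔ ∀ t, dist (f t) (g t) ≤ C := by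
  rw [← ZeroAtInftyContinuousMap.dist_toBCF_eq_dist]
  exact BoundedContinuousFunction.dist_le hC

theorem continuous_stretch {A : Type} [NonUnitalCStarAlgebra A] (c : uI) (f : C₀(I01, A)) :
    Continuous fun s => stretch c s f := by
  refine Metric.continuous_iff.2 fun s ε hε => ?_
  obtain ⟨δ, hδ, h⟩ := Metric.uniformContinuous_iff.1 (uniformContinuous_extendZero f) _
    (half_pos hε)
  refine ⟨δ, hδ, fun s' hs' => lt_of_le_of_lt ?_ (half_lt_self hε)⟩
  refine (dist_suspension_le (half_pos hε).le).2 fun t => (h ?_).le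
  rw [Real.dist_eq] at hs' ⊢
  have h1 : |(t : ℝ) - c| ≤ 1 :=
    abs_le.2 ⟨by linarith [t.2.1, c.2.2], by linarith [t.2.2, c.2.1]⟩
  calc |(1 + |s'|) * (t : ℝ) - c * |s'| - ((1 + |s|) * t - c * |s|)|
      = |(|s'| - |s|)| * |(t : ℝ) - c| := by rw [← abs_mul]; ring_nf
    _ ≤ |s' - s| * 1 :=
        mul_le_mul (abs_abs_sub_abs_le s' s) h1 (abs_nonneg _) (abs_nonneg _)
    _ < δ := by rwa [mul_one]

/-- The suspension of a separable C*-algebra is separable. -/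
theorem separableSpace_suspension {A : Type} [NonUnitalCStarAlgebra A]
    [TopologicalSpace.SeparableSpace A] : TopologicalSpace.SeparableSpace C₀(I01, A) := by
  have := UniformSpace.secondCountable_of_separable A
  let ι : C₀(I01, A) → C(uI, A) := fun f =>
    ⟨fun t => extendZero f t, (continuous_extendZero f).comp continuous_subtype_val⟩
  have hι : Isometry ι := by
    refine Isometry.of_dist_eq fun f g => le_antisymm ?_ ?_
    · refine (ContinuousMap.dist_le dist_nonneg).2 fun t => ?_
      change dist (extendZero f t) (extendZero g t) ≤ _
      by_cases ht : (t : ℝ) ∈ I01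
      · rw [extendZero_of_mem f ht, extendZero_of_mem g ht]
        exact (dist_suspension_le dist_nonneg).1 le_rfl _
      · simp [extendZero_of_notMem _ ht]
    · refine (dist_suspension_le dist_nonneg).2 fun t => ?_
      have := ContinuousMap.dist_apply_le_dist (f := ι f) (g := ι g)
        ⟨t, Ioo_subset_Icc_self t.2⟩
      change dist (extendZero f t) (extendZero g t) ≤ _ at this
      rwa [extendZero_of_mem f t.2, extendZero_of_mem g t.2] at this
  have := hι.isUniformInducing.isInducing.secondCountableTopology
  infer_instance

/-- The bundled form of a `*`-homomorphism. -/
def IsStarHom.toHom {A B : Type} [NonUnitalCStarAlgebra A] [NonUnitalCStarAlgebra B] {φ : A → B}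
    (h : IsStarHom φ) : A →⋆ₙₐ[ℂ] B where
  toFun := φ
  map_smul' := h.2.1
  map_zero' := by simpa using h.2.1 0 0
  map_add' := h.1
  map_mul' := h.2.2.1
  map_star' := h.2.2.2

theorem IsStarHom.continuous {A B : Type} [NonUnitalCStarAlgebra A] [NonUnitalCStarAlgebra B]
    {φ : A → B} (h : IsStarHom φ) : Continuous φ :=
  AddMonoidHomClass.continuous_of_bound h.toHom 1 fun a => by
    simpa using NonUnitalStarAlgHom.norm_apply_le h.toHom a

theorem IsStarHom.comp {A B C : Type} [NonUnitalCStarAlgebra A] [NonUnitalCStarAlgebra B]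
    [NonUnitalCStarAlgebra C] {φ : A → B} {ψ : B → C} (hψ : IsStarHom ψ) (hφ : IsStarHom φ) :
    IsStarHom (ψ ∘ φ) := by
  obtain ⟨a1, a2, a3, a4⟩ := hφ
  obtain ⟨b1, b2, b3, b4⟩ := hψ
  exact ⟨by simp [*], by simp [*], by simp [*], by simp [*]⟩

/-- A `*`-homomorphism on the suspension is homotopic to its precomposition with a stretch. -/
theorem joinedIn_comp_stretch {A B : Type} [NonUnitalCStarAlgebra A] [NonUnitalCStarAlgebra B]
    {φ : C₀(I01, A) → B} (hφ : IsStarHom φ) (c : uI) :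
    JoinedIn {ψ : C₀(I01, A) → B | IsStarHom ψ} φ (φ ∘ stretch c 1) := by
  refine JoinedIn.ofLine (f := fun s => φ ∘ stretch c s) ?_ ?_ rfl ?_
  · exact (continuous_pi fun f => hφ.continuous.comp (continuous_stretch c f)).continuousOn
  · ext f
    simp [stretch_zero]
  · rintro - ⟨s, -, rfl⟩
    exact hφ.comp (isStarHom_stretch c s)

theorem IsStarHom.conj {A B : Type} [NonUnitalCStarAlgebra A] [CStarAlgebra B]
    {φ : A → B} (h : IsStarHom φ) {x : B} (hx : ∀ a b, φ a * (star x * x) * φ b = φ a * φ b) :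
    IsStarHom fun a => x * φ a * star x := by
  obtain ⟨h1, h2, h3, h4⟩ := h
  refine ⟨fun a b => by simp only [h1]; noncomm_ring, fun z a => by simp [h2], fun a b => ?_,
    fun a => by simp [h4, mul_assoc]⟩
  calc x * φ (a * b) * star x = x * (φ a * (star x * x) * φ b) * star x := by rw [hx, h3]
    _ = _ := by simp only [mul_assoc]

/-- Conjugates of `φ` by two isometries with orthogonal ranges, relative to `φ`, are homotopic by
rotating one isometry into the other. -/
theorem joinedIn_conj {A B : Type} [NonUnitalCStarAlgebra A] [CStarAlgebra B]
    {φ : A → B} (h : IsStarHom φ) {v w : B} (hv : star v * v = 1) (hw : star w * w = 1)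
    (hvw : ∀ a b, φ a * (star v * w) * φ b = 0) :
    JoinedIn {ψ : A → B | IsStarHom ψ} (fun a => v * φ a * star v)
      (fun a => w * φ a * star w) := by
  have hwv (a b : A) : φ a * (star w * v) * φ b = 0 := by
    have := congrArg star (hvw (star b) (star a))
    simpa [h.2.2.2, mul_assoc] using this
  let x : ℝ → B := fun s =>
    (Real.cos (Real.pi / 2 * s) : ℂ) • v + (Real.sin (Real.pi / 2 * s) : ℂ) • w
  have hx : Continuous x := by fun_prop
  refine JoinedIn.ofLine (f := fun s a => x s * φ a * star (x s)) ?_ ?_ ?_ ?_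
  · exact (continuous_pi fun a => by fun_prop).continuousOn
  · simp [x]
  · simp [x]
  · rintro - ⟨s, -, rfl⟩
    refine h.conj fun a b => ?_
    have hsum : (Real.cos (Real.pi / 2 * s) : ℂ) * Real.cos (Real.pi / 2 * s)
        + (Real.sin (Real.pi / 2 * s) : ℂ) * Real.sin (Real.pi / 2 * s) = 1 := by
      norm_cast
      nlinarith [Real.sin_sq_add_cos_sq (Real.pi / 2 * s)]
    simp only [x]
    generalize (Real.cos (Real.pi / 2 * s)) = α at *
    generalize (Real.sin (Real.pi / 2 * s)) = β at *
    have : star ((α : ℂ) • v + (β : ℂ) • w) * ((α : ℂ) • v + (β : ℂ) • w)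
        = 1 + (α * β : ℂ) • (star v * w) + (α * β : ℂ) • (star w * v) := by
      simp only [star_add, star_smul, RCLike.star_def, Complex.conj_ofReal, add_mul, mul_add,
        smul_mul_smul_comm, hv, hw]
      have hone : ((α : ℂ) * α) • (1 : B) + ((β : ℂ) * β) • (1 : B) = 1 := by
        rw [← add_smul, hsum, one_smul]
      linear_combination (norm := module) hone
    rw [this]
    simp [mul_add, add_mul, hvw, hwv]

/-- A separable C*-algebra contains an element whose right annihilator, under every
`*`-homomorphism, is that of the whole image. -/
theorem exists_forall_map_mul_eq_zero (B : Type) [NonUnitalCStarAlgebra B]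
    [TopologicalSpace.SeparableSpace B] : ∃ z : B, ∀ (Q : Type) [CStarAlgebra Q] (ψ : B → Q),
      IsStarHom ψ → ∀ w : Q, ψ z * w = 0 → ∀ b, ψ b * w = 0 := by
  let a : ℕ → ℝ := fun n => (1 / 2) ^ n / (1 + ‖TopologicalSpace.denseSeq B n‖)
  have ha (n : ℕ) : 0 < a n := by positivity
  let d : ℕ → B := fun n => (a n : ℂ) • TopologicalSpace.denseSeq B n
  have hd (n : ℕ) : ‖star (d n) * d n‖ ≤ (1 / 2) ^ n := by
    have h1 : ‖d n‖ ≤ (1 / 2) ^ n := by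
      rw [norm_smul, Complex.norm_real, Real.norm_of_nonneg (ha n).le, div_mul_eq_mul_div,
        div_le_iff₀ (by positivity)]
      gcongr
      linarith
    have h2 : ((1 : ℝ) / 2) ^ n ≤ 1 := pow_le_one₀ (by norm_num) (by norm_num)
    rw [CStarRing.norm_star_mul_self]
    nlinarith [norm_nonneg (d n)]
  have hs : Summable fun n => star (d n) * d n :=
    Summable.of_norm_bounded (summable_geometric_of_lt_one (by norm_num) (by norm_num)) hd
  refine ⟨∑' n, star (d n) * d n, fun Q _ ψ hψ w hw => ?_⟩
  let : PartialOrder Q := CStarAlgebra.spectralOrder Q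
  have : StarOrderedRing Q := CStarAlgebra.spectralOrderedRing Q
  have hsum : HasSum (fun n => star (ψ (d n) * w) * (ψ (d n) * w)) 0 := by
    have h1 := ((hs.hasSum.map hψ.toHom hψ.continuous).mul_left (star w)).mul_right w
    convert! h1 using 1
    · ext n
      change _ = star w * ψ (star (d n) * d n) * w
      rw [hψ.2.2.1, hψ.2.2.2, star_mul]
      simp only [mul_assoc]
    · change _ = star w * ψ _ * w
      rw [mul_assoc, hw, mul_zero]
  have hzero := (hasSum_zero_iff_of_nonneg fun n => star_mul_self_nonneg _).1 hsum
  have hdense (n : ℕ) : ψ (TopologicalSpace.denseSeq B n) * w = 0 := by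
    have h1 : ψ (d n) * w = 0 := CStarRing.star_mul_self_eq_zero_iff _ |>.1 (congrFun hzero n)
    rw [hψ.2.1, smul_mul_assoc, smul_eq_zero] at h1
    exact h1.resolve_left (by exact_mod_cast (ha n).ne')
  have hc : Continuous fun b => ψ b * w := hψ.continuous.mul continuous_const
  intro b
  exact congrFun (hc.ext_on (TopologicalSpace.denseRange_denseSeq B) (continuous_const (y := 0))
    (by rintro - ⟨n, rfl⟩; exact hdense n)) b

/-- In a C*-algebra where every element that is not left invertible annihilates an isometry,
a pair of isometries can be shrunk so as to have orthogonal ranges. -/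
theorem exists_orthogonal_isometries {Q : Type} [CStarAlgebra Q] [Nontrivial Q]
    (hL : ∀ y : Q, ¬ IsUnit (star y * y) → ∃ w : Q, star w * w = 1 ∧ y * w = 0)
    {v₁ v₂ w : Q} (hv₁ : star v₁ * v₁ = 1) (hv₂ : star v₂ * v₂ = 1) (hv : star v₁ * v₂ = 0)
    (hw : star w * w = 1) :
    ∃ x y : Q, star (w * x) * (w * x) = 1 ∧ star (v₁ * y) * (v₁ * y) = 1 ∧
      star (w * x) * (v₁ * y) = 0 := by
  have hiso {a b : Q} (ha : star a * a = 1) (hb : star b * b = 1) :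
      star (a * b) * (a * b) = 1 := by
    rw [star_mul, mul_assoc, ← mul_assoc (star a), ha, one_mul, hb]
  by_cases hc : IsUnit (star (star w * v₁) * (star w * v₁))
  · obtain ⟨u, hu⟩ := hc
    have ht : ¬ IsUnit (star (star (star w * v₁ * v₁)) * star (star w * v₁ * v₁)) := by
      intro ht
      have h0 : star (star w * v₁ * v₁) * (star w * v₁ * ↑u⁻¹ * v₂) = 0 := by
        calc star (star w * v₁ * v₁) * (star w * v₁ * ↑u⁻¹ * v₂)
            = star v₁ * ((star (star w * v₁) * (star w * v₁)) * ↑u⁻¹) * v₂ := by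
              simp only [star_mul, mul_assoc]
          _ = 0 := by rw [← hu, Units.mul_inv, mul_one, hv]
      have h1 : star w * v₁ * ↑u⁻¹ * v₂ = 0 := by
        rw [← ht.mul_right_eq_zero, mul_assoc, h0, mul_zero]
      have h2 : v₂ = 0 := by
        calc v₂ = (star (star w * v₁) * (star w * v₁)) * ↑u⁻¹ * v₂ := by
              rw [← hu, Units.mul_inv, one_mul]
          _ = star (star w * v₁) * (star w * v₁ * ↑u⁻¹ * v₂) := by simp only [mul_assoc]
          _ = 0 := by rw [h1, mul_zero]
      simp [h2] at hv₂
    obtain ⟨x, hx, hx0⟩ := hL _ ht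
    refine ⟨x, v₁, hiso hw hx, hiso hv₁ hv₁, ?_⟩
    simpa [mul_assoc] using congrArg star hx0
  · obtain ⟨y, hy, hy0⟩ := hL _ hc
    refine ⟨1, y, by simpa using hw, hiso hv₁ hy, by simpa [mul_assoc] using hy0⟩

/-- After one of the two extremal stretches, the image of the suspension annihilates an
isometry. -/
theorem exists_isometry_forall_comp_stretch_mul_eq_zero {A : Type} [NonUnitalCStarAlgebra A]
    [TopologicalSpace.SeparableSpace A] {Q : Type} [CStarAlgebra Q] [Nontrivial Q]
    (hL : ∀ y : Q, ¬ IsUnit (star y * y) → ∃ w : Q, star w * w = 1 ∧ y * w = 0)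
    {φ : C₀(I01, A) → Q} (hφ : IsStarHom φ) :
    ∃ (c : uI) (w : Q), star w * w = 1 ∧ ∀ f, φ (stretch c 1 f) * w = 0 := by
  have := separableSpace_suspension (A := A)
  obtain ⟨z, hz⟩ := exists_forall_map_mul_eq_zero C₀(I01, A)
  suffices h : ∃ c : uI, ¬ IsUnit (star (φ (stretch c 1 z)) * φ (stretch c 1 z)) by
    obtain ⟨c, hc⟩ := h
    obtain ⟨w, hw, hw0⟩ := hL _ hc
    exact ⟨c, w, hw, hz Q _ (hφ.comp (isStarHom_stretch c 1)) w hw0⟩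
  by_contra! h
  have h0 : φ (stretch 0 1 z) * star (φ (stretch 1 1 z)) = 0 := by
    rw [← hφ.2.2.2, ← (isStarHom_stretch 1 1).2.2.2, ← hφ.2.2.1, stretch_zero_mul_stretch_one]
    simpa using hφ.2.1 0 0
  refine ((h 0).mul (h 1)).ne_zero ?_
  rw [mul_assoc, ← mul_assoc (φ _), h0, zero_mul, mul_zero]

/-- A `*`-homomorphism `φ` on a separable suspension is homotopic to `φ ⊕ 0`. -/
theorem joinedIn_conj_of_isometries {A : Type} [NonUnitalCStarAlgebra A]
    [TopologicalSpace.SeparableSpace A] {Q : Type} [CStarAlgebra Q] [Nontrivial Q]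
    (hL : ∀ y : Q, ¬ IsUnit (star y * y) → ∃ w : Q, star w * w = 1 ∧ y * w = 0)
    {v₁ v₂ : Q} (hv₁ : star v₁ * v₁ = 1) (hv₂ : star v₂ * v₂ = 1)
    (hv : v₁ * star v₁ + v₂ * star v₂ = 1) {φ : C₀(I01, A) → Q} (hφ : IsStarHom φ) :
    JoinedIn {ψ : C₀(I01, A) → Q | IsStarHom ψ} φ (fun x => v₁ * φ x * star v₁) := by
  have hv₁₂ : star v₁ * v₂ = 0 := by
    have h1 := congrArg (fun x => star v₁ * x * v₂) hv
    simpa [mul_add, add_mul, ← mul_assoc, hv₁, mul_assoc _ (star v₂) v₂, hv₂] using h1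
  have hv₂₁ : star v₂ * v₁ = 0 := by simpa using congrArg star hv₁₂
  obtain ⟨c, w, hw, hw0⟩ := exists_isometry_forall_comp_stretch_mul_eq_zero hL hφ
  obtain ⟨x, y, hx, hy, hxy⟩ := exists_orthogonal_isometries hL hv₁ hv₂ hv₁₂ hw
  have hψ : IsStarHom (φ ∘ stretch c 1) := hφ.comp (isStarHom_stretch c 1)
  have h1 := joinedIn_conj hψ (v := 1) (by simp) hx fun f g => by
    rw [star_one, one_mul, ← mul_assoc, Function.comp_apply, hw0, zero_mul, zero_mul]
  have h2 := joinedIn_conj hψ hx hy fun f g => by rw [hxy, mul_zero, zero_mul]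
  have h3 := joinedIn_conj hψ hy hv₂ fun f g => by
    rw [star_mul, mul_assoc (star y), hv₁₂, mul_zero, mul_zero, zero_mul]
  have h4 := joinedIn_conj hψ hv₂ hv₁ fun f g => by rw [hv₂₁, mul_zero, zero_mul]
  have h5 := joinedIn_comp_stretch (hφ.conj (x := v₁) fun a b => by rw [hv₁, mul_one]) c
  simp only [one_mul, star_one, mul_one] at h1
  exact (joinedIn_comp_stretch hφ c).trans
    (h1.trans (h2.trans (h3.trans (h4.trans h5.symm))))

/-- used in Theorem 18 of Manuilov–Thomsen.  With `Q` the Calkin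
algebra and `V₁, V₂ ∈ B(ℓ²)` isometries with `V₁V₁* + V₂V₂* = 1`, every
`*`-homomorphism `φ : SA → Q` is strongly homotopic to `φ ⊕ 0 = q(V₁) φ(·) q(V₁)*`. -/
theorem stmt16
    -- `A` is a separable C*-algebra
    {A : Type} [NonUnitalCStarAlgebra A] [TopologicalSpace.SeparableSpace A]
    -- `ℓ²`: a separable infinite dimensional complex Hilbert space
    {H : Type} [NormedAddCommGroup H] [InnerProductSpace ℂ H] [CompleteSpace H]
    [TopologicalSpace.SeparableSpace H] (hinf : ¬ FiniteDimensional ℂ H)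
    -- the Calkin algebra `Q = B(ℓ²)/𝒦(ℓ²)` with quotient map `q`
    {Q : Type} [CStarAlgebra Q]
    (q : (H →L[ℂ] H) → Q) (hq : IsStarHom q) (hq1 : q 1 = 1)
    (hqsurj : Function.Surjective q)
    (hqker : ∀ T : H →L[ℂ] H, q T = 0 ↔ IsCompactOperator T)
    -- `V₁, V₂` are isometries with `V₁V₁* + V₂V₂* = 1`
    (V₁ V₂ : H →L[ℂ] H) (hV₁ : star V₁ * V₁ = 1) (hV₂ : star V₂ * V₂ = 1)
    (hV : V₁ * star V₁ + V₂ * star V₂ = 1)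
    -- `φ : SA → Q` is a `*`-homomorphism
    (φ : C₀(I01, A) → Q) (hφ : IsStarHom φ) :
    ∃ Φ : ℝ → C₀(I01, A) → Q,
      (∀ s ∈ Set.Icc (0:ℝ) 1, IsStarHom (Φ s)) ∧
      Φ 0 = φ ∧ Φ 1 = (fun x => q V₁ * φ x * star (q V₁)) ∧
      ∀ x, ContinuousOn (fun s => Φ s x) (Set.Icc (0:ℝ) 1) := by
  have hq0 : q 0 = 0 := by simpa using hq.2.1 0 0
  let q' : (H →L[ℂ] H) →⋆ₐ[ℂ] Q :=
    { toFun := q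
      map_one' := hq1
      map_mul' := hq.2.2.1
      map_zero' := hq0
      map_add' := hq.1
      commutes' := fun r => by rw [Algebra.algebraMap_eq_smul_one, hq.2.1, hq1,
        Algebra.algebraMap_eq_smul_one]
      map_star' := hq.2.2.2 }
  have : Nontrivial Q := ⟨1, 0, fun h => hinf <|
    FiniteDimensional.of_isCompactOperator_id ((hqker 1).1 (hq1.trans h))⟩
  have hL (y : Q) (hy : ¬ IsUnit (star y * y)) : ∃ w : Q, star w * w = 1 ∧ y * w = 0 :=
    exists_isometry_mul_eq_zero q' hqsurj hqker y hy
  have hv₁ : star (q V₁) * q V₁ = 1 := by rw [← hq.2.2.2, ← hq.2.2.1, hV₁, hq1]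
  have hv₂ : star (q V₂) * q V₂ = 1 := by rw [← hq.2.2.2, ← hq.2.2.1, hV₂, hq1]
  have hv : q V₁ * star (q V₁) + q V₂ * star (q V₂) = 1 := by
    rw [← hq.2.2.2, ← hq.2.2.2, ← hq.2.2.1, ← hq.2.2.1, ← hq.1, hV, hq1]
  suffices h : JoinedIn {ψ : C₀(I01, A) → Q | IsStarHom ψ} φ
      (fun x => q V₁ * φ x * star (q V₁)) by
    obtain ⟨γ, hγ⟩ := h
    refine ⟨γ.extend, fun s hs => ?_, γ.extend_zero, γ.extend_one, fun x => ?_⟩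
    · rw [γ.extend_apply hs]
      exact hγ _
    · exact ((continuous_apply x).comp γ.continuous_extend).continuousOn
  exact joinedIn_conj_of_isometries hL hv₁ hv₂ hv hφ

end
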